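/- For every s ≥ 0, the function x ↦ Ω_s(x) is continuous on ℝ \ {0}. -/

import Mathlib

open Complex Filter Finset

noncomputable section

/-- `ρ = e^{iπ/4}`. -/
def ρ : ℂ := Complex.exp (Real.pi * Complex.I / 4)

/-- Partial sum `F_{s,n}(x,t) = Σ_{k=1}^{n} e^{iπk²x + 2πikt}/k^s`. -/
def Fpart (s : ℝ) (n : ℕ) (x t : ℝ) : ℂ :=
  ∑ k ∈ Finset.Icc 1 n,
    Complex.exp (Real.pi * Complex.I * (k : ℂ) ^ 2 * (x : ℂ)
        + 2 * Real.pi * Complex.I * (k : ℂ) * (t : ℂ)) / (k : ℂ) ^ (s : ℂ)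

/-- The function `I_s(x,t)` (for `x > 0`). -/
def Ifun (s x t : ℝ) : ℂ :=
  (∫ u : ℝ, ρ *
      (Complex.exp (Real.pi * Complex.I * ((1 : ℂ) / 2 + ρ * (u : ℂ)) ^ 2 * (x : ℂ)
            + 2 * Real.pi * Complex.I * ((1 : ℂ) / 2 + ρ * (u : ℂ)) * (Int.fract t : ℝ)) /
        (((1 : ℂ) / 2 + ρ * (u : ℂ)) ^ (s : ℂ) *
          (1 - Complex.exp (2 * Real.pi * Complex.I * ((1 : ℂ) / 2 + ρ * (u : ℂ)))))))
  + ρ * (x : ℂ) ^ (s : ℂ) *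
    ∫ u : ℝ, (Real.exp (-(Real.pi * x * u ^ 2)) : ℝ) *
      ∑' k : ℕ, Complex.exp (-(Real.pi * Complex.I * (((k : ℂ) + 1) - (Int.fract t : ℝ)) ^ 2 / (x : ℂ))) *
        (((ρ * (x : ℂ) * (u : ℂ) + ((k : ℂ) + 1) - (Int.fract t : ℝ)) ^ (s : ℂ))⁻¹
          - (((k : ℂ) + 1) ^ (s : ℂ))⁻¹)

/-- `Ω_s(x,t)`. -/
def Omega (s x t : ℝ) : ℂ :=
  if 0 < x then Ifun s x t else (starRingEnd ℂ) (Ifun s (-x) (-t))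

/-- `Ω_s(x) = Ω_s(x,0)`. -/
def Omega0 (s x : ℝ) : ℂ := Omega s x 0

/-- The map `T(x) = -1/x mod 2`, valued in `(-1,1]`. -/
def Tmap (x : ℝ) : ℝ := -1 / x - 2 * ⌈((-1 / x) - 1) / 2⌉

/-- Denominator `Q_n` of the `n`-th convergent of the regular continued fraction of `x`. -/
def Qden (x : ℝ) (n : ℕ) : ℝ := (GenContFract.of x).dens n

end

lemma rho_eq : ρ = ((√2 / 2 : ℝ) : ℂ) + ((√2 / 2 : ℝ) : ℂ) * Complex.I := by
  have h : (Real.pi * Complex.I / 4 : ℂ) = ((Real.pi / 4 : ℝ) : ℂ) * Complex.I := by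
    push_cast; ring
  rw [ρ, h, Complex.exp_mul_I, ← Complex.ofReal_cos, ← Complex.ofReal_sin,
    Real.cos_pi_div_four, Real.sin_pi_div_four]

lemma rho_re : ρ.re = √2 / 2 := by simp [rho_eq]

lemma rho_im : ρ.im = √2 / 2 := by simp [rho_eq]

lemma norm_rho : ‖ρ‖ = 1 := by
  have h : (Real.pi * Complex.I / 4 : ℂ) = ((Real.pi / 4 : ℝ) : ℂ) * Complex.I := by
    push_cast; ring
  rw [ρ, h, Complex.norm_exp_ofReal_mul_I]

lemma half_le_norm_add_rho_mul (a y : ℝ) :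
    a / 2 ≤ ‖(a : ℂ) + ρ * (y : ℂ)‖ := by
  refine le_of_sq_le_sq ?_ (norm_nonneg _)
  have h2 : √2 * √2 = 2 := Real.mul_self_sqrt (by norm_num)
  rw [← Complex.normSq_eq_norm_sq, Complex.normSq_apply]
  simp only [Complex.add_re, Complex.add_im, Complex.mul_re, Complex.mul_im, Complex.ofReal_re,
    Complex.ofReal_im, rho_re, rho_im]
  nlinarith [sq_nonneg (a + √2 * y), sq_nonneg a, mul_self_nonneg (√2 * y)]

lemma add_rho_mul_mem_slitPlane {a : ℝ} (ha : 0 < a) (y : ℝ) :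
    (a : ℂ) + ρ * (y : ℂ) ∈ Complex.slitPlane := by
  rw [Complex.mem_slitPlane_iff]
  simp only [Complex.add_re, Complex.add_im, Complex.mul_re, Complex.mul_im, Complex.ofReal_re,
    Complex.ofReal_im, rho_re, rho_im]
  rcases eq_or_ne y 0 with rfl | hy
  · left; simpa using ha
  · right; simpa using hy

lemma half_le_norm_one_add_exp (v : ℝ) :
    1 / 2 ≤ ‖1 + Complex.exp (-(v : ℂ) + v * Complex.I)‖ := by
  have hn : ‖Complex.exp (-(v : ℂ) + v * Complex.I)‖ = Real.exp (-v) := by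
    simp [Complex.norm_exp]
  rcases le_or_gt |v| 1 with h | h
  · refine le_trans ?_ (Complex.re_le_norm _)
    have hc : 0 < Real.cos v := Real.cos_pos_of_le_one h
    have : 0 < Real.exp (-v) * Real.cos v := by positivity
    simp [Complex.exp_re]
    linarith
  · rcases lt_abs.1 h with h | h
    · have h1 : Real.exp (-v) ≤ 1 / 2 := by
        rw [Real.exp_neg, inv_le_comm₀ (Real.exp_pos _) (by norm_num)]
        linarith [Real.add_one_le_exp v]
      have := norm_sub_le_norm_add (1 : ℂ) (Complex.exp (-(v : ℂ) + v * Complex.I))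
      rw [hn, norm_one] at this
      linarith
    · have h1 := Real.add_one_le_exp (-v)
      have := norm_sub_le_norm_add (Complex.exp (-(v : ℂ) + v * Complex.I)) (1 : ℂ)
      rw [hn, norm_one, add_comm] at this
      linarith

lemma half_le_norm_one_sub_exp (u : ℝ) :
    1 / 2 ≤ ‖1 - Complex.exp (2 * Real.pi * Complex.I * ((1 : ℂ) / 2 + ρ * (u : ℂ)))‖ := by
  have h : Complex.exp (2 * Real.pi * Complex.I * ((1 : ℂ) / 2 + ρ * (u : ℂ)))
      = -Complex.exp (-((√2 * Real.pi * u : ℝ) : ℂ) + (√2 * Real.pi * u : ℝ) * Complex.I) := by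
    rw [rho_eq, show 2 * Real.pi * Complex.I * ((1 : ℂ) / 2 + (((√2 / 2 : ℝ) : ℂ)
        + ((√2 / 2 : ℝ) : ℂ) * Complex.I) * (u : ℂ)) = (-((√2 * Real.pi * u : ℝ) : ℂ)
        + (√2 * Real.pi * u : ℝ) * Complex.I) + Real.pi * Complex.I by
      push_cast; ring_nf; rw [Complex.I_sq]; ring, Complex.exp_add, Complex.exp_pi_mul_I]
    ring
  rw [h, sub_neg_eq_add]
  exact half_le_norm_one_add_exp _

lemma norm_exp_gaussian (x u : ℝ) :
    ‖Complex.exp (Real.pi * Complex.I * ((1 : ℂ) / 2 + ρ * (u : ℂ)) ^ 2 * (x : ℂ))‖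
      = Real.exp (-(Real.pi * x * (u ^ 2 + √2 / 2 * u))) := by
  have h2 : √2 ^ 2 = 2 := Real.sq_sqrt (by norm_num)
  have h2' : ((√2 : ℝ) : ℂ) ^ 2 = 2 := by exact_mod_cast congrArg Complex.ofReal h2
  have h : (Real.pi * Complex.I * ((1 : ℂ) / 2 + ρ * (u : ℂ)) ^ 2 * (x : ℂ))
      = ((-(Real.pi * x * (u ^ 2 + √2 / 2 * u)) : ℝ) : ℂ)
        + ((Real.pi * x * (1 / 4 + √2 / 2 * u) : ℝ) : ℂ) * Complex.I := by
    rw [rho_eq]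
    push_cast
    linear_combination (Real.pi * x * (√2 / 2 * u + √2 ^ 2 / 2 * u ^ 2
      + Complex.I * √2 ^ 2 / 4 * u ^ 2) : ℂ) * Complex.I_sq - (Real.pi * x * u ^ 2 / 2 : ℂ) * h2'
  rw [h, Complex.norm_exp, Complex.add_re, Complex.ofReal_re, Complex.re_ofReal_mul,
    Complex.I_re, mul_zero, add_zero]

lemma continuousOn_contour_integral (s : ℝ) (hs : 0 ≤ s) :
    ContinuousOn (fun x : ℝ => ∫ u : ℝ, ρ *
      (Complex.exp (Real.pi * Complex.I * ((1 : ℂ) / 2 + ρ * (u : ℂ)) ^ 2 * (x : ℂ)) /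
        (((1 : ℂ) / 2 + ρ * (u : ℂ)) ^ (s : ℂ) *
          (1 - Complex.exp (2 * Real.pi * Complex.I * ((1 : ℂ) / 2 + ρ * (u : ℂ)))))))
      (Set.Ioi 0) := by
  intro x₀ hx₀
  have hx₀ : 0 < x₀ := hx₀
  have hpi := Real.pi_pos
  refine ContinuousAt.continuousWithinAt ?_
  refine MeasureTheory.continuousAt_of_dominated (bound := fun u => Real.exp (Real.pi * x₀ / 2) *
    Real.exp (-(Real.pi * x₀ / 4) * u ^ 2) / ((1 / 4) ^ s * (1 / 2))) ?_ ?_ ?_ ?_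
  · refine Eventually.of_forall fun x => Measurable.aestronglyMeasurable ?_
    fun_prop
  · filter_upwards [Ioo_mem_nhds (show x₀ / 2 < x₀ by linarith) (show x₀ < 2 * x₀ by linarith)]
      with x hx
    refine Eventually.of_forall fun u => ?_
    rw [norm_mul, norm_rho, one_mul, norm_div, norm_mul, norm_exp_gaussian, ← Real.exp_add,
      Complex.norm_cpow_real]
    have hz := half_le_norm_add_rho_mul (1 / 2) u
    push_cast at hz
    have h2 : √2 * √2 = 2 := Real.mul_self_sqrt (by norm_num)
    have hq : u ^ 2 / 2 - 1 / 4 ≤ u ^ 2 + √2 / 2 * u := by nlinarith [sq_nonneg (u + √2 / 2)]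
    have hxpos : 0 < x := by linarith [hx.1]
    have h1 := mul_le_mul_of_nonneg_left hq (by positivity : 0 ≤ Real.pi * x)
    have h3 := mul_le_mul_of_nonneg_left hx.1.le (by positivity : 0 ≤ Real.pi * u ^ 2)
    have h4 := mul_le_mul_of_nonneg_left hx.2.le hpi.le
    refine div_le_div₀ (Real.exp_pos _).le (Real.exp_le_exp.2 (by nlinarith)) (by positivity) ?_
    refine mul_le_mul (Real.rpow_le_rpow (by norm_num) (by linarith) hs)
      (half_le_norm_one_sub_exp u) (by norm_num) (by positivity)
  · exact ((integrable_exp_neg_mul_sq (by positivity)).const_mul _).div_const _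
  · refine Eventually.of_forall fun u => Continuous.continuousAt ?_
    fun_prop

lemma norm_inv_cpow_sub_inv_cpow_le {s a : ℝ} (hs : 0 ≤ s) (ha : 0 < a) (y : ℝ) :
    ‖(((a : ℂ) + ρ * (y : ℂ)) ^ (s : ℂ))⁻¹ - ((a : ℂ) ^ (s : ℂ))⁻¹‖
      ≤ s * (a / 2) ^ (-s - 1) * |y| := by
  have hd : ∀ y ∈ (Set.univ : Set ℝ), HasDerivWithinAt
      (fun y : ℝ => ((a : ℂ) + ρ * (y : ℂ)) ^ (-s : ℂ))
      ((-s : ℂ) * ((a : ℂ) + ρ * (y : ℂ)) ^ (-s - 1 : ℂ) * ρ) Set.univ y := by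
    intro y _
    have h0 : HasDerivAt (fun z : ℂ => (a : ℂ) + ρ * z) ρ (y : ℂ) := by
      simpa using ((hasDerivAt_id (y : ℂ)).const_mul ρ).const_add (a : ℂ)
    exact (h0.cpow_const (add_rho_mul_mem_slitPlane ha y)).comp_ofReal.hasDerivWithinAt
  have hb : ∀ y ∈ (Set.univ : Set ℝ),
      ‖(-s : ℂ) * ((a : ℂ) + ρ * (y : ℂ)) ^ (-s - 1 : ℂ) * ρ‖ ≤ s * (a / 2) ^ (-s - 1) := by
    intro y _
    have he : (-s - 1 : ℂ) = ((-s - 1 : ℝ) : ℂ) := by push_cast; ring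
    rw [norm_mul, norm_mul, norm_rho, mul_one, he, Complex.norm_cpow_real, norm_neg,
      Complex.norm_real, Real.norm_of_nonneg hs]
    exact mul_le_mul_of_nonneg_left (Real.rpow_le_rpow_of_nonpos (by positivity)
      (half_le_norm_add_rho_mul a y) (by linarith)) hs
  have := convex_univ.norm_image_sub_le_of_norm_hasDerivWithin_le hd hb (Set.mem_univ 0)
    (Set.mem_univ y)
  simpa [Complex.cpow_neg] using this

/-- The `k`-th term of the series in the second integral defining `Ifun s x 0`. -/
noncomputable def seriesTerm (s x u : ℝ) (k : ℕ) : ℂ :=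
  Complex.exp (-(Real.pi * Complex.I * ((k : ℂ) + 1) ^ 2 / (x : ℂ))) *
    (((ρ * (x : ℂ) * (u : ℂ) + ((k : ℂ) + 1)) ^ (s : ℂ))⁻¹ - (((k : ℂ) + 1) ^ (s : ℂ))⁻¹)

lemma norm_seriesTerm_le {s : ℝ} (hs : 0 ≤ s) (x u : ℝ) (k : ℕ) :
    ‖seriesTerm s x u k‖ ≤ s * (((k : ℝ) + 1) / 2) ^ (-s - 1) * |x * u| := by
  have he : ‖Complex.exp (-(Real.pi * Complex.I * ((k : ℂ) + 1) ^ 2 / (x : ℂ)))‖ = 1 := by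
    have : (-(Real.pi * Complex.I * ((k : ℂ) + 1) ^ 2 / (x : ℂ)))
        = ((-(Real.pi * ((k : ℝ) + 1) ^ 2 / x) : ℝ) : ℂ) * Complex.I := by
      push_cast; ring
    rw [this, Complex.norm_exp_ofReal_mul_I]
  have h := norm_inv_cpow_sub_inv_cpow_le hs (show (0 : ℝ) < (k : ℝ) + 1 by positivity) (x * u)
  rw [seriesTerm, norm_mul, he, one_mul]
  convert h using 5 <;> push_cast
  · ring_nf
  · rfl

lemma summable_seriesTerm_bound {s : ℝ} (hs : 0 ≤ s) :
    Summable fun k : ℕ => s * (((k : ℝ) + 1) / 2) ^ (-s - 1) := by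
  rcases hs.eq_or_lt with rfl | hs
  · simp
  refine Summable.mul_left _ ?_
  have h := ((summable_nat_add_iff 1).2
    (Real.summable_nat_rpow.2 (show -s - 1 < -1 by linarith))).div_const ((2 : ℝ) ^ (-s - 1))
  refine h.congr fun k => ?_
  rw [Real.div_rpow (by positivity) (by norm_num)]
  push_cast
  rfl

lemma summable_seriesTerm {s : ℝ} (hs : 0 ≤ s) (x u : ℝ) : Summable (seriesTerm s x u) :=
  Summable.of_norm_bounded ((summable_seriesTerm_bound hs).mul_right _)
    (norm_seriesTerm_le hs x u)

lemma continuousAt_seriesTerm (s u : ℝ) (k : ℕ) {x : ℝ} (hx : x ≠ 0) :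
    ContinuousAt (fun x => seriesTerm s x u k) x := by
  have hx' : (x : ℂ) ≠ 0 := by exact_mod_cast hx
  have hm : ρ * (x : ℂ) * (u : ℂ) + ((k : ℂ) + 1) ∈ Complex.slitPlane := by
    have := add_rho_mul_mem_slitPlane (show (0 : ℝ) < (k : ℝ) + 1 by positivity) (x * u)
    push_cast at this
    rwa [add_comm, ← mul_assoc] at this
  have hne : (ρ * (x : ℂ) * (u : ℂ) + ((k : ℂ) + 1)) ^ (s : ℂ) ≠ 0 := by
    rw [Complex.cpow_ne_zero_iff]
    exact Or.inl (Complex.slitPlane_ne_zero hm)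
  unfold seriesTerm
  refine ContinuousAt.mul ?_ (ContinuousAt.sub (ContinuousAt.inv₀ ?_ hne) continuousAt_const)
  · exact Complex.continuous_exp.continuousAt.comp
      ((continuousAt_const.div Complex.continuous_ofReal.continuousAt hx').neg)
  · exact ContinuousAt.cpow (by fun_prop) continuousAt_const hm

lemma measurable_tsum_seriesTerm {s : ℝ} (hs : 0 ≤ s) (x : ℝ) :
    Measurable fun u => ∑' k, seriesTerm s x u k := by
  refine measurable_of_tendsto_metrizable
    (f := fun n u => ∑ k ∈ Finset.range n, seriesTerm s x u k) (fun n => ?_)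
    (tendsto_pi_nhds.2 fun u => (summable_seriesTerm hs x u).hasSum.tendsto_sum_nat)
  unfold seriesTerm
  fun_prop

lemma continuousOn_tsum_seriesTerm {s : ℝ} (hs : 0 ≤ s) (u : ℝ) {a b : ℝ} (ha : 0 ≤ a) :
    ContinuousOn (fun x => ∑' k, seriesTerm s x u k) (Set.Ioo a b) := by
  refine continuousOn_tsum (u := fun k : ℕ => s * (((k : ℝ) + 1) / 2) ^ (-s - 1) * (b * |u|))
    (fun k x hx => (continuousAt_seriesTerm s u k
      (ha.trans_lt hx.1).ne').continuousWithinAt)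
    ((summable_seriesTerm_bound hs).mul_right _) fun k x hx => ?_
  refine (norm_seriesTerm_le hs x u k).trans ?_
  rw [abs_mul, abs_of_pos (ha.trans_lt hx.1)]
  gcongr
  exact hx.2.le

lemma continuousOn_series_integral {s : ℝ} (hs : 0 ≤ s) :
    ContinuousOn (fun x : ℝ => ∫ u : ℝ, (Real.exp (-(Real.pi * x * u ^ 2)) : ℝ) *
      ∑' k : ℕ, seriesTerm s x u k) (Set.Ioi 0) := by
  intro x₀ hx₀
  have hx₀ : 0 < x₀ := hx₀
  have hpi := Real.pi_pos
  have hmem := Ioo_mem_nhds (show x₀ / 2 < x₀ by linarith) (show x₀ < 2 * x₀ by linarith)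
  set S : ℝ := ∑' k : ℕ, s * (((k : ℝ) + 1) / 2) ^ (-s - 1)
  have hS0 : 0 ≤ S := tsum_nonneg fun k => by positivity
  refine ContinuousAt.continuousWithinAt ?_
  refine MeasureTheory.continuousAt_of_dominated (bound := fun u =>
    S * (2 * x₀) * ‖u * Real.exp (-(Real.pi * x₀ / 2) * u ^ 2)‖) ?_ ?_ ?_ ?_
  · refine Eventually.of_forall fun x => Measurable.aestronglyMeasurable ?_
    have := measurable_tsum_seriesTerm hs x
    fun_prop
  · filter_upwards [hmem] with x hx
    refine Eventually.of_forall fun u => ?_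
    have hxpos : 0 < x := by linarith [hx.1]
    have h1 : ‖∑' k : ℕ, seriesTerm s x u k‖ ≤ S * |x * u| :=
      tsum_of_norm_bounded ((summable_seriesTerm_bound hs).hasSum.mul_right _)
        (norm_seriesTerm_le hs x u)
    have h2 : |x * u| ≤ 2 * x₀ * |u| := by
      rw [abs_mul, abs_of_pos hxpos]
      gcongr
      exact hx.2.le
    have h3 : Real.exp (-(Real.pi * x * u ^ 2)) ≤ Real.exp (-(Real.pi * x₀ / 2) * u ^ 2) := by
      have := mul_le_mul_of_nonneg_left hx.1.le (by positivity : 0 ≤ Real.pi * u ^ 2)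
      exact Real.exp_le_exp.2 (by nlinarith)
    rw [norm_mul, Complex.norm_real, norm_mul, Real.norm_eq_abs u, Real.norm_of_nonneg
      (Real.exp_pos _).le, Real.norm_of_nonneg (Real.exp_pos _).le]
    calc _ ≤ Real.exp (-(Real.pi * x₀ / 2) * u ^ 2) * (S * (2 * x₀ * |u|)) :=
          mul_le_mul h3 (h1.trans (mul_le_mul_of_nonneg_left h2 hS0)) (norm_nonneg _)
            (Real.exp_pos _).le
      _ = _ := by ring
  · exact (integrable_mul_exp_neg_mul_sq (by positivity)).norm.const_mul _
  · refine Eventually.of_forall fun u => ContinuousAt.mul (Continuous.continuousAt ?_)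
      ((continuousOn_tsum_seriesTerm hs u (by positivity)).continuousAt hmem)
    fun_prop

lemma continuousOn_Ifun_zero {s : ℝ} (hs : 0 ≤ s) :
    ContinuousOn (fun x => Ifun s x 0) (Set.Ioi 0) := by
  have hpow : ContinuousOn (fun x : ℝ => ρ * (x : ℂ) ^ (s : ℂ)) (Set.Ioi 0) := fun x hx =>
    (continuousAt_const.mul (ContinuousAt.cpow Complex.continuous_ofReal.continuousAt
      continuousAt_const (Complex.ofReal_mem_slitPlane.2 hx))).continuousWithinAt
  refine ((continuousOn_contour_integral s hs).add
    (hpow.mul (continuousOn_series_integral hs))).congr fun x _ => ?_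
  simp [Ifun, seriesTerm]

/-- `Ω_s` is continuous on `ℝ \ {0}`. -/
theorem stmt5 (s : ℝ) (hs : 0 ≤ s) :
    ContinuousOn (fun x : ℝ => Omega0 s x) {x : ℝ | x ≠ 0} := by
  intro x hx
  refine ContinuousAt.continuousWithinAt ?_
  rcases lt_or_gt_of_ne (show x ≠ 0 from hx) with h | h
  · have h1 : ContinuousAt (fun y => (starRingEnd ℂ) (Ifun s (-y) 0)) x :=
      Complex.continuous_conj.continuousAt.comp
        (ContinuousAt.comp (f := fun y : ℝ => -y) (g := fun y => Ifun s y 0)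
          ((continuousOn_Ifun_zero hs).continuousAt (Ioi_mem_nhds (by linarith)))
          continuous_neg.continuousAt)
    refine h1.congr ?_
    filter_upwards [Iio_mem_nhds h] with y hy
    simp [Omega0, Omega, not_lt.2 (le_of_lt (show y < 0 from hy))]
  · refine ((continuousOn_Ifun_zero hs).continuousAt (Ioi_mem_nhds h)).congr ?_
    filter_upwards [Ioi_mem_nhds h] with y hy
    simp [Omega0, Omega, show 0 < y from hy]
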